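/- Let H_S ⊗ H_A be a tensor product of finite-dimensional Hilbert spaces with dim H_A = D_A. Let ρ_i = (e^{−βH_S}/Z) ⊗ |φ₀⟩⟨φ₀| where Z = Tr[e^{−βH_S}], β > 0, and |φ₀⟩ ∈ H_A is a unit vector. Let U be any unitary on H_S ⊗ H_A and ρ_f = U ρ_i U†. Then Tr[(H_S ⊗ 1) ρ_f] ≥ Tr[(H_S ⊗ 1) ρ_i] − β^{−1} log D_A. -/

import Mathlib

open Matrix BigOperators Kronecker
open scoped ComplexOrder

/-- Spectral functional calculus for Hermitian matrices (junk value `0` otherwise). -/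
noncomputable def matFun {n : ℕ} (f : ℝ → ℝ) (A : Matrix (Fin n) (Fin n) ℂ) :
    Matrix (Fin n) (Fin n) ℂ :=
  if hA : A.IsHermitian then
    (hA.eigenvectorUnitary : Matrix (Fin n) (Fin n) ℂ) *
      Matrix.diagonal (fun i => (f (hA.eigenvalues i) : ℂ)) *
      star (hA.eigenvectorUnitary : Matrix (Fin n) (Fin n) ℂ)
  else 0

/-- Matrix logarithm. -/
noncomputable def matLog {n : ℕ} (A : Matrix (Fin n) (Fin n) ℂ) : Matrix (Fin n) (Fin n) ℂ :=
  matFun Real.log A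

/-- Von Neumann entropy `S(ρ) = −Tr[ρ log ρ]`. -/
noncomputable def vN {n : ℕ} (ρ : Matrix (Fin n) (Fin n) ℂ) : ℝ :=
  -(Matrix.trace (ρ * matLog ρ)).re

/-- Canonical Gibbs state `e^{−βH}/Tr[e^{−βH}]`. -/
noncomputable def gibbs {n : ℕ} (β : ℝ) (H : Matrix (Fin n) (Fin n) ℂ) :
    Matrix (Fin n) (Fin n) ℂ :=
  ((matFun (fun x => Real.exp (-β * x)) H).trace)⁻¹ • matFun (fun x => Real.exp (-β * x)) H

theorem mul_conjTranspose_diag {ι κ : Type*} [Fintype κ] (N : Matrix ι κ ℂ) (x : ι) :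
    (N * Nᴴ) x x = ((∑ i, Complex.normSq (N x i) : ℝ) : ℂ) := by
  simp [Matrix.mul_apply, Complex.mul_conj]

/-- The rows of a matrix with orthonormal columns have squared norm at most one. -/
theorem row_sum_normSq_le_one {ι κ : Type*} [Fintype ι] [Fintype κ] [DecidableEq κ]
    (M : Matrix ι κ ℂ) (hM : Mᴴ * M = 1) (x : ι) :
    ∑ i, Complex.normSq (M x i) ≤ 1 := by
  set P := M * Mᴴ with hP
  have hPP : P * Pᴴ = P := by
    rw [hP, conjTranspose_mul, conjTranspose_conjTranspose, Matrix.mul_assoc,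
      ← Matrix.mul_assoc Mᴴ, hM, Matrix.one_mul]
  have hd := mul_conjTranspose_diag M x
  have hs := mul_conjTranspose_diag P x
  rw [hPP, hP, hd, ← hP] at hs
  have hs' := Complex.ofReal_injective hs
  set r := ∑ i, Complex.normSq (M x i)
  have hle : Complex.normSq (P x x) ≤ ∑ y, Complex.normSq (P x y) :=
    Finset.single_le_sum (f := fun y => Complex.normSq (P x y))
      (fun _ _ => Complex.normSq_nonneg _) (Finset.mem_univ x)
  rw [← hs', hP, hd, Complex.normSq_ofReal] at hle
  nlinarith

/-- The columns of a matrix with orthonormal columns have squared norm one. -/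
theorem col_sum_normSq_eq_one {ι κ : Type*} [Fintype ι] [DecidableEq κ]
    (M : Matrix ι κ ℂ) (hM : Mᴴ * M = 1) (i : κ) :
    ∑ x, Complex.normSq (M x i) = 1 := by
  have h : (Mᴴ * M) i i = ((∑ x, Complex.normSq (M x i) : ℝ) : ℂ) := by
    simp [Matrix.mul_apply, Complex.normSq_eq_conj_mul_self]
  rw [hM, one_apply_eq] at h
  exact_mod_cast h.symm

theorem trace_diagonal_conj_diagonal {ι κ : Type*} [Fintype ι] [Fintype κ] [DecidableEq ι]
    [DecidableEq κ] (M : Matrix ι κ ℂ) (e : ι → ℝ) (p : κ → ℝ) :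
    (Matrix.trace (diagonal (fun x => (e x : ℂ)) *
      (M * diagonal (fun i => (p i : ℂ)) * Mᴴ))).re =
      ∑ i, ∑ x, p i * Complex.normSq (M x i) * e x := by
  rw [Finset.sum_comm]
  simp only [Matrix.trace, diag_apply, diagonal_mul, Complex.re_sum]
  refine Finset.sum_congr rfl fun x _ => ?_
  rw [Complex.re_ofReal_mul, Matrix.mul_apply, Complex.re_sum, Finset.mul_sum]
  refine Finset.sum_congr rfl fun i _ => ?_
  rw [mul_diagonal, conjTranspose_apply, Complex.star_def, mul_right_comm, Complex.mul_conj,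
    ← Complex.ofReal_mul, Complex.ofReal_re]
  ring

/-- Mean energy decrease of a Gibbs distribution under transition probabilities `T i (j, a)`
with unit row sums and column sums at most one. -/
theorem gibbs_sum_energy_le {m d : ℕ} (hd : 0 < d) (β : ℝ) (hβ : 0 < β)
    (e p : Fin m → ℝ) (hp : ∀ i, 0 < p i) (hp1 : ∑ i, p i = 1)
    (hratio : ∀ i j, p j = p i * Real.exp (β * (e i - e j)))
    (T : Fin m → Fin m × Fin d → ℝ) (hT : ∀ i x, 0 ≤ T i x)
    (hrow : ∀ i, ∑ x, T i x = 1) (hcol : ∀ x, ∑ i, T i x ≤ 1) :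
    ∑ i, p i * e i - β⁻¹ * Real.log d ≤ ∑ i, ∑ x, p i * T i x * e x.1 := by
  have hd' : (0 : ℝ) < d := by exact_mod_cast hd
  have key : ∀ i x, p i * T i x * (β * e i) - p i * T i x * (β * e x.1) ≤
      T i x * (p x.1 / d) - p i * T i x + p i * T i x * Real.log d := by
    intro i x
    have h := Real.add_one_le_exp (β * (e i - e x.1) - Real.log d)
    rw [Real.exp_sub, Real.exp_log hd'] at h
    have h2 := mul_le_mul_of_nonneg_left h (mul_nonneg (hp i).le (hT i x))
    rw [hratio i x.1]
    have h3 : p i * T i x * (Real.exp (β * (e i - e x.1)) / d) =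
      T i x * (p i * Real.exp (β * (e i - e x.1)) / d) := by ring
    linarith
  have hsum := Finset.sum_le_sum fun i (_ : i ∈ Finset.univ) =>
    Finset.sum_le_sum fun x (_ : x ∈ Finset.univ) => key i x
  simp only [Finset.sum_add_distrib, Finset.sum_sub_distrib] at hsum
  have h1 : ∀ c : Fin m → ℝ, ∑ i, ∑ x, p i * T i x * c i = ∑ i, p i * c i := by
    intro c
    refine Finset.sum_congr rfl fun i _ => ?_
    rw [← Finset.sum_mul, ← Finset.mul_sum, hrow, mul_one]
  have h2 : ∑ i, ∑ x, p i * T i x = 1 := by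
    simp only [← Finset.mul_sum, hrow, mul_one, hp1]
  have h3 : ∑ i, ∑ x, T i x * (p x.1 / d) ≤ 1 := by
    rw [Finset.sum_comm]
    calc ∑ x : Fin m × Fin d, ∑ i, T i x * (p x.1 / d)
        ≤ ∑ x : Fin m × Fin d, p x.1 / d := by
          refine Finset.sum_le_sum fun x _ => ?_
          rw [← Finset.sum_mul]
          exact mul_le_of_le_one_left (div_pos (hp _) hd').le (hcol x)
      _ = 1 := by
          rw [Fintype.sum_prod_type]
          simp only [Finset.sum_const, Finset.card_univ, Fintype.card_fin, nsmul_eq_mul]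
          simp only [mul_div_cancel₀ _ hd'.ne', hp1]
  have h4 : ∑ i, ∑ x, p i * T i x * (β * e x.1) = β * ∑ i, ∑ x, p i * T i x * e x.1 := by
    simp only [Finset.mul_sum]
    exact Finset.sum_congr rfl fun i _ => Finset.sum_congr rfl fun x _ => by ring
  have h5 : ∑ i, p i * (β * e i) = β * ∑ i, p i * e i := by
    rw [Finset.mul_sum]
    exact Finset.sum_congr rfl fun i _ => by ring
  rw [h1 fun i => β * e i, h1 fun _ => Real.log d, h2, h4, h5, ← Finset.sum_mul, hp1] at hsum
  rw [← mul_le_mul_iff_right₀ hβ, mul_sub, mul_inv_cancel_left₀ hβ.ne']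
  linarith

/-- The Gibbs state is diagonal in the energy eigenbasis, with Boltzmann weights. -/
theorem gibbs_eq {m : ℕ} (β : ℝ) (H : Matrix (Fin m) (Fin m) ℂ) (hH : H.IsHermitian) :
    gibbs β H = (hH.eigenvectorUnitary : Matrix (Fin m) (Fin m) ℂ) *
      diagonal (fun i => (((Real.exp (-β * hH.eigenvalues i)) /
        ∑ j, Real.exp (-β * hH.eigenvalues j) : ℝ) : ℂ)) *
      (hH.eigenvectorUnitary : Matrix (Fin m) (Fin m) ℂ)ᴴ := by
  have htr : (matFun (fun x => Real.exp (-β * x)) H).trace =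
      ((∑ j, Real.exp (-β * hH.eigenvalues j) : ℝ) : ℂ) := by
    rw [matFun, dif_pos hH, trace_mul_comm, ← Matrix.mul_assoc, Unitary.coe_star_mul_self,
      Matrix.one_mul, trace_diagonal, Complex.ofReal_sum]
  rw [gibbs, htr, matFun, dif_pos hH, ← star_eq_conjTranspose, ← Matrix.smul_mul,
    ← Matrix.mul_smul, ← diagonal_smul]
  congr 3
  ext i
  simp [div_eq_inv_mul]

/-- Theorem 1 of the paper: for an initial canonical system state tensored with a pure
apparatus state and any unitary evolution of the joint system,
`Tr[(H_S ⊗ 1) ρ_f] ≥ Tr[(H_S ⊗ 1) ρ_i] − β⁻¹ log D_A`. -/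
theorem stmt5 {m d : ℕ} (hd : 0 < d)
    (HS : Matrix (Fin m) (Fin m) ℂ) (hHS : HS.IsHermitian)
    (β : ℝ) (hβ : 0 < β)
    (φ : Fin d → ℂ) (hφ : ∑ i, ‖φ i‖ ^ 2 = 1)
    (U : Matrix (Fin m × Fin d) (Fin m × Fin d) ℂ)
    (hU : U ∈ Matrix.unitaryGroup (Fin m × Fin d) ℂ) :
    (Matrix.trace ((HS ⊗ₖ (1 : Matrix (Fin d) (Fin d) ℂ)) *
        (U * ((gibbs β HS) ⊗ₖ Matrix.vecMulVec φ (star φ)) * Uᴴ))).re ≥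
      (Matrix.trace ((HS ⊗ₖ (1 : Matrix (Fin d) (Fin d) ℂ)) *
        ((gibbs β HS) ⊗ₖ Matrix.vecMulVec φ (star φ)))).re - β⁻¹ * Real.log d := by
  rcases Nat.eq_zero_or_pos m with rfl | hm
  · have hlog : 0 ≤ β⁻¹ * Real.log d :=
      mul_nonneg (inv_pos.2 hβ).le (Real.log_natCast_nonneg d)
    simpa [Matrix.trace] using hlog
  have : Nonempty (Fin m) := ⟨⟨0, hm⟩⟩
  set V : Matrix (Fin m) (Fin m) ℂ := ↑hHS.eigenvectorUnitary with hV
  set e := hHS.eigenvalues with he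
  have hVV : Vᴴ * V = 1 := Unitary.coe_star_mul_self hHS.eigenvectorUnitary
  have hVV' : V * Vᴴ = 1 := Unitary.coe_mul_star_self hHS.eigenvectorUnitary
  have hH : HS = V * diagonal (fun i => (e i : ℂ)) * Vᴴ := hHS.spectral_theorem
  have hZ : 0 < ∑ j, Real.exp (-β * e j) :=
    Finset.sum_pos (fun _ _ => Real.exp_pos _) Finset.univ_nonempty
  set p : Fin m → ℝ := fun i => Real.exp (-β * e i) / ∑ j, Real.exp (-β * e j) with hp
  have hG : gibbs β HS = V * diagonal (fun i => (p i : ℂ)) * Vᴴ := gibbs_eq β HS hHS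
  have hφ' : ∑ a, φ a * star (φ a) = 1 := by
    simp only [Complex.star_def, Complex.mul_conj, Complex.normSq_eq_norm_sq]
    exact_mod_cast hφ
  set C : Matrix (Fin d) Unit ℂ := replicateCol Unit φ with hC
  have hCC : Cᴴ * C = 1 := by
    ext i j
    simpa [hC, Matrix.mul_apply, mul_comm] using hφ'
  have hCC' : vecMulVec φ (star φ) = C * (1 : Matrix Unit Unit ℂ) * Cᴴ := by
    ext a b
    rw [Matrix.mul_one]
    simp [hC, Matrix.mul_apply, vecMulVec_apply]
  have hUU : Uᴴ * U = 1 := Matrix.mem_unitaryGroup_iff'.1 hU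
  set E : Matrix (Fin m × Fin d) (Fin m × Fin d) ℂ := V ⊗ₖ 1 with hE
  set F : Matrix (Fin m × Fin d) (Fin m × Unit) ℂ := V ⊗ₖ C with hF
  have hEE : E * Eᴴ = 1 := by
    rw [hE, conjTranspose_kronecker, ← mul_kronecker_mul, hVV', conjTranspose_one,
      Matrix.mul_one, one_kronecker_one]
  have hFF : Fᴴ * F = 1 := by
    rw [hF, conjTranspose_kronecker, ← mul_kronecker_mul, hVV, hCC, one_kronecker_one]
  have hE1 : HS ⊗ₖ (1 : Matrix (Fin d) (Fin d) ℂ) =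
      E * diagonal (fun x => (e x.1 : ℂ)) * Eᴴ := by
    have : diagonal (fun x : Fin m × Fin d => (e x.1 : ℂ)) =
        diagonal (fun i => (e i : ℂ)) ⊗ₖ 1 := by
      rw [← diagonal_one, diagonal_kronecker_diagonal]
      simp
    rw [this, hE, conjTranspose_kronecker, ← mul_kronecker_mul, ← mul_kronecker_mul, ← hH,
      conjTranspose_one, Matrix.mul_one, Matrix.mul_one]
  have hF1 : gibbs β HS ⊗ₖ vecMulVec φ (star φ) =
      F * (diagonal (fun x => (p x.1 : ℂ)) : Matrix (Fin m × Unit) (Fin m × Unit) ℂ) * Fᴴ := by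
    have : diagonal (fun x : Fin m × Unit => (p x.1 : ℂ)) =
        diagonal (fun i => (p i : ℂ)) ⊗ₖ 1 := by
      rw [← diagonal_one, diagonal_kronecker_diagonal]
      simp
    rw [this, hF, conjTranspose_kronecker, ← mul_kronecker_mul, ← mul_kronecker_mul, hG, hCC']
  set M := Eᴴ * (U * F) with hMdef
  have hM : Mᴴ * M = 1 := by
    rw [hMdef, conjTranspose_mul, conjTranspose_conjTranspose, Matrix.mul_assoc,
      ← Matrix.mul_assoc E, hEE, Matrix.one_mul, conjTranspose_mul, Matrix.mul_assoc,
      ← Matrix.mul_assoc Uᴴ, hUU, Matrix.one_mul, hFF]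
  have hfinal : (Matrix.trace ((HS ⊗ₖ (1 : Matrix (Fin d) (Fin d) ℂ)) *
      (U * ((gibbs β HS) ⊗ₖ Matrix.vecMulVec φ (star φ)) * Uᴴ))).re =
      ∑ i : Fin m, ∑ x : Fin m × Fin d, p i * Complex.normSq (M x (i, ())) * e x.1 := by
    have h := trace_diagonal_conj_diagonal M (fun x => e x.1) (fun x => p x.1)
    rw [Fintype.sum_prod_type] at h
    simp only [Finset.univ_unique, Finset.sum_singleton, PUnit.default_eq_unit] at h
    rw [← h, hE1, hF1, Matrix.mul_assoc E, Matrix.mul_assoc E, trace_mul_comm E, hMdef]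
    simp only [conjTranspose_mul, conjTranspose_conjTranspose, Matrix.mul_assoc]
  have hinit : (Matrix.trace ((HS ⊗ₖ (1 : Matrix (Fin d) (Fin d) ℂ)) *
      ((gibbs β HS) ⊗ₖ Matrix.vecMulVec φ (star φ)))).re = ∑ i, p i * e i := by
    have hP : Matrix.trace (vecMulVec φ (star φ)) = 1 := by
      simpa [Matrix.trace, vecMulVec_apply] using hφ'
    have hHG : HS * gibbs β HS =
        V * (diagonal (fun i => (e i : ℂ)) * diagonal (fun i => (p i : ℂ)) * Vᴴ) := by
      rw [hG]
      nth_rewrite 1 [hH]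
      rw [Matrix.mul_assoc, Matrix.mul_assoc V _ Vᴴ, ← Matrix.mul_assoc Vᴴ V, hVV,
        Matrix.one_mul, Matrix.mul_assoc, Matrix.mul_assoc]
    rw [← mul_kronecker_mul, trace_kronecker, Matrix.one_mul, hP, mul_one, hHG, trace_mul_comm,
      Matrix.mul_assoc, hVV, Matrix.mul_one, diagonal_mul_diagonal, trace_diagonal,
      Complex.re_sum]
    refine Finset.sum_congr rfl fun i _ => ?_
    rw [← Complex.ofReal_mul, Complex.ofReal_re, mul_comm]
  rw [hfinal, hinit, ge_iff_le]
  refine gibbs_sum_energy_le hd β hβ e p (fun i => div_pos (Real.exp_pos _) hZ) ?_ ?_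
    (fun i x => Complex.normSq (M x (i, ()))) (fun _ _ => Complex.normSq_nonneg _)
    (fun i => col_sum_normSq_eq_one M hM (i, ())) fun x => ?_
  · rw [hp, ← Finset.sum_div, div_self hZ.ne']
  · intro i j
    simp only [hp]
    rw [div_mul_eq_mul_div, ← Real.exp_add]
    congr 2
    ring
  · have h := row_sum_normSq_le_one M hM x
    rw [Fintype.sum_prod_type] at h
    simpa using h
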